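/- For every integer n ≥ 2, the set U_{n,1/2} consists of exactly the n−1 points ((i−1)/n, 1/2, …, 1/2, −1, 1/2, …, 1/2) (with −1 in slot i) for i ∈ {2,…,n}, the set V_{n,1/2} = V_cube ∪ U_{n,1/2} has cardinality 2ⁿ + n − 1, and the set of extreme points of G_n^{1/2} equals V_{n,1/2}. In particular, for n > 2 the number of vertices of G_n^{1/2} differs from the number 2^{n−2}(n+3) of vertices of G_n^ε for 0 ≤ ε < 1/2. -/

import Mathlib

open Set

noncomputable section

/-- The vertex set `{0,1}ⁿ` of the unit cube in `ℝⁿ`. -/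
def Vcube (n : ℕ) : Set (Fin n → ℝ) := {x | ∀ j, x j = 0 ∨ x j = 1}

/-- The set `U_{n,ε}` of extra vertices of the Goodwillie polytope.  Here the
index `i : Fin n` with `i ≠ 0` corresponds to the coordinate subscript
`i + 1 ∈ {2,…,n}`, so the first coordinate `(subscript − 1)/n` equals `i/n`. -/
def Uset (n : ℕ) [NeZero n] (ε : ℝ) : Set (Fin n → ℝ) :=
  {x | ∃ i : Fin n, i ≠ 0 ∧ x 0 = ((i : ℕ) : ℝ) / (n : ℝ) ∧ x i = -1 ∧
        ∀ j : Fin n, j ≠ 0 → j ≠ i → (x j = ε ∨ x j = 1 - ε)}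

/-- The Goodwillie polytope `G_n^ε`: the convex hull of `V_{n,ε} = V_cube ∪ U_{n,ε}`. -/
def Gpoly (n : ℕ) [NeZero n] (ε : ℝ) : Set (Fin n → ℝ) :=
  convexHull ℝ (Vcube n ∪ Uset n ε)

/-- A point of `V` at which a linear functional is uniquely maximal over `V` is an extreme point
of the convex hull of `V`. -/
theorem mem_extremePoints_convexHull_of_forall_lt {E : Type*} [AddCommGroup E] [Module ℝ E]
    {V : Set E} {v : E} (hv : v ∈ V) (f : E →ₗ[ℝ] ℝ) (hf : ∀ x ∈ V, x ≠ v → f x < f v) :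
    v ∈ (convexHull ℝ V).extremePoints ℝ := by
  have hsub : convexHull ℝ V ⊆ {x | x ≠ v → f x < f v} := by
    refine convexHull_min hf ?_
    intro x hx y hy a b ha hb hab hne
    rw [map_add, map_smul, map_smul, smul_eq_mul, smul_eq_mul]
    by_cases hxv : x = v
    · by_cases hyv : y = v
      · exact absurd (by rw [hxv, hyv, ← add_smul, hab, one_smul]) hne
      · have hb0 : b ≠ 0 := by
          rintro rfl
          apply hne
          rw [hxv, zero_smul, add_zero, (by linarith : a = 1), one_smul]
        have := mul_lt_mul_of_pos_left (hy hyv) (lt_of_le_of_ne hb hb0.symm)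
        rw [hxv]
        calc a * f v + b * f y < a * f v + b * f v := by linarith
          _ = f v := by rw [← add_mul, hab, one_mul]
    · have hy' : f y ≤ f v := by
        by_cases hyv : y = v
        · rw [hyv]
        · exact (hy hyv).le
      rcases ha.eq_or_lt with rfl | ha0
      · obtain rfl : b = 1 := by linarith
        simp only [zero_smul, one_smul, zero_add] at hne
        simpa using hy hne
      · have h1 := mul_lt_mul_of_pos_left (hx hxv) ha0
        have h2 := mul_le_mul_of_nonneg_left hy' hb
        calc a * f x + b * f y < a * f v + b * f v := by linarith
          _ = f v := by rw [← add_mul, hab, one_mul]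
  refine ⟨subset_convexHull ℝ V hv, ?_⟩
  rintro x hx y hy ⟨a, b, ha, hb, hab, h⟩
  by_contra hne
  have h1 := mul_lt_mul_of_pos_left (hsub hx hne) ha
  have hy' : f y ≤ f v := by
    by_cases hyv : y = v
    · rw [hyv]
    · exact (hsub hy hyv).le
  have h2 := mul_le_mul_of_nonneg_left hy' hb.le
  have h3 : f v = a * f x + b * f y := by
    rw [← h, map_add, map_smul, map_smul, smul_eq_mul, smul_eq_mul]
  have h4 : a * f v + b * f v = f v := by rw [← add_mul, hab, one_mul]
  linarith

theorem Vcube_eq_piFinset (n : ℕ) :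
    Vcube n = (Fintype.piFinset fun _ : Fin n => ({0, 1} : Finset ℝ) : Set (Fin n → ℝ)) := by
  ext x
  simp [Vcube]

theorem ncard_Vcube (n : ℕ) : (Vcube n).ncard = 2 ^ n := by
  rw [Vcube_eq_piFinset, Set.ncard_coe_finset, Fintype.card_piFinset]
  simp

/-- The point `(i/n, 1/2, …, 1/2, -1, 1/2, …, 1/2)` with `-1` in slot `i`. -/
def halfPoint (n : ℕ) [NeZero n] (i : Fin n) : Fin n → ℝ :=
  fun j => if j = 0 then ((i : ℕ) : ℝ) / (n : ℝ) else if j = i then -1 else 1 / 2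

theorem Uset_half (n : ℕ) [NeZero n] :
    Uset n (1 / 2) = {x : Fin n → ℝ | ∃ i : Fin n, i ≠ 0 ∧ x = halfPoint n i} := by
  ext x
  constructor
  · rintro ⟨i, hi, h0, h1, h⟩
    refine ⟨i, hi, funext fun j => ?_⟩
    unfold halfPoint
    split_ifs with hj hji
    · rw [hj, h0]
    · rw [hji, h1]
    · rcases h j hj hji with h | h <;> rw [h]
      norm_num
  · rintro ⟨i, hi, rfl⟩
    refine ⟨i, hi, by simp [halfPoint], by simp [halfPoint, hi], fun j hj hji => ?_⟩
    simp [halfPoint, hj, hji]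

theorem halfPoint_injOn (n : ℕ) [NeZero n] : Set.InjOn (halfPoint n) {i | i ≠ 0} := by
  intro i hi k hk h
  by_contra hik
  have := congrFun h i
  have hi' : i ≠ 0 := hi
  simp only [halfPoint, if_neg hi', if_true, if_neg hik] at this
  norm_num at this

theorem Uset_half_eq_image (n : ℕ) [NeZero n] :
    Uset n (1 / 2) = halfPoint n '' {i | i ≠ 0} := by
  rw [Uset_half]
  ext x
  simp [eq_comm]

theorem ncard_Uset_half (n : ℕ) [NeZero n] : (Uset n (1 / 2)).ncard = n - 1 := by
  rw [Uset_half_eq_image, (halfPoint_injOn n).ncard_image]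
  have : {i : Fin n | i ≠ 0} = {0}ᶜ := by ext; simp
  rw [this, Set.ncard_compl, Set.ncard_singleton, Nat.card_fin]

theorem disjoint_Vcube_Uset (n : ℕ) [NeZero n] (ε : ℝ) : Disjoint (Vcube n) (Uset n ε) := by
  rw [Set.disjoint_left]
  rintro x hx ⟨i, -, -, h, -⟩
  rcases hx i with h' | h' <;> rw [h] at h' <;> norm_num at h'

theorem halfPoint_mem_extremePoints (n : ℕ) [NeZero n] {i : Fin n} (hi : i ≠ 0) :
    halfPoint n i ∈ (Gpoly n (1 / 2)).extremePoints ℝ := by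
  have hmem : halfPoint n i ∈ Uset n (1 / 2) := by
    rw [Uset_half]
    exact ⟨i, hi, rfl⟩
  refine mem_extremePoints_convexHull_of_forall_lt (Or.inr hmem) (-LinearMap.proj i) ?_
  have hval : halfPoint n i i = -1 := by simp [halfPoint, hi]
  rintro x (hx | hx) hne
  · simp only [LinearMap.neg_apply, LinearMap.proj_apply, hval]
    rcases hx i with h | h <;> rw [h] <;> norm_num
  · rw [Uset_half] at hx
    obtain ⟨k, -, rfl⟩ := hx
    have hik : i ≠ k := by
      rintro rfl
      exact hne rfl
    simp only [LinearMap.neg_apply, LinearMap.proj_apply, hval]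
    simp only [halfPoint, if_neg hi, if_neg hik]
    norm_num

theorem Vcube_subset_extremePoints (n : ℕ) [NeZero n] :
    Vcube n ⊆ (Gpoly n (1 / 2)).extremePoints ℝ := by
  intro v hv
  have hn : (0 : ℝ) < n := by exact_mod_cast Nat.pos_of_ne_zero (NeZero.ne n)
  -- The functional has large weight on the first coordinate, where `Uset` avoids `{0, 1}`.
  let f : (Fin n → ℝ) →ₗ[ℝ] ℝ := ∑ j, (2 * v j - 1) • LinearMap.proj j +
    (2 * (n : ℝ) ^ 2 * (2 * v 0 - 1)) • LinearMap.proj 0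
  have hf : ∀ x, f v - f x = ∑ j, (2 * v j - 1) * (v j - x j) +
      2 * (n : ℝ) ^ 2 * ((2 * v 0 - 1) * (v 0 - x 0)) := by
    intro x
    simp only [f, LinearMap.add_apply, LinearMap.sum_apply, LinearMap.smul_apply,
      LinearMap.proj_apply, smul_eq_mul, mul_sub, Finset.sum_sub_distrib]
    ring
  refine mem_extremePoints_convexHull_of_forall_lt (Or.inl hv) f ?_
  intro x hx hne
  rw [← sub_pos, hf]
  rcases hx with hx | hx
  · have hnonneg : ∀ j, 0 ≤ (2 * v j - 1) * (v j - x j) := by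
      intro j
      rcases hv j with h | h <;> rcases hx j with h' | h' <;> rw [h, h'] <;> norm_num
    have hsum : 0 < ∑ j, (2 * v j - 1) * (v j - x j) := by
      obtain ⟨j, hj⟩ := Function.ne_iff.mp hne
      refine Finset.sum_pos' (fun j _ => hnonneg j) ⟨j, Finset.mem_univ j, ?_⟩
      rcases hv j with h | h <;> rcases hx j with h' | h' <;> rw [h, h'] at hj ⊢ <;>
        first | exact absurd rfl hj | norm_num
    have := mul_nonneg (by positivity : 0 ≤ 2 * (n : ℝ) ^ 2) (hnonneg 0)
    linarith
  · rw [Uset_half] at hx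
    obtain ⟨i, hi, rfl⟩ := hx
    have hi1 : (1 : ℝ) ≤ (i : ℕ) := by
      exact_mod_cast Nat.one_le_iff_ne_zero.mpr (fun h => hi (Fin.ext (by simpa using h)))
    have hin : ((i : ℕ) : ℝ) + 1 ≤ n := by exact_mod_cast i.isLt
    have h0 : halfPoint n i 0 = (i : ℕ) / n := by simp [halfPoint]
    have hfirst : 1 / (n : ℝ) ≤ (2 * v 0 - 1) * (v 0 - halfPoint n i 0) := by
      rw [h0, div_le_iff₀ hn]
      have hcancel : ((i : ℕ) : ℝ) / n * n = (i : ℕ) := div_mul_cancel₀ _ hn.ne'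
      rcases hv 0 with h | h <;> rw [h] <;> nlinarith
    have hzero : 0 < (2 * v 0 - 1) * (v 0 - halfPoint n i 0) :=
      lt_of_lt_of_le (by positivity) hfirst
    have hsum : ∑ _j : Fin n, (-1 : ℝ) ≤ ∑ j, (2 * v j - 1) * (v j - halfPoint n i j) := by
      refine Finset.sum_le_sum fun j _ => ?_
      by_cases hj : j = 0
      · subst hj
        linarith
      · simp only [halfPoint, if_neg hj]
        rcases hv j with h | h <;> rw [h] <;> split_ifs <;> norm_num
    have hbig := mul_le_mul_of_nonneg_left hfirst (by positivity : 0 ≤ 2 * (n : ℝ) ^ 2)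
    have heq : 2 * (n : ℝ) ^ 2 * (1 / n) = 2 * n := by field_simp
    rw [heq] at hbig
    simp only [Finset.sum_const, Finset.card_univ, Fintype.card_fin, nsmul_eq_mul] at hsum
    linarith

theorem two_pow_add_ne (n : ℕ) (hn : 2 < n) : 2 ^ n + n - 1 ≠ 2 ^ (n - 2) * (n + 3) := by
  obtain ⟨m, rfl⟩ := Nat.exists_eq_add_of_lt hn
  have h1 : 2 + m + 1 - 2 = m + 1 := by omega
  have h2 : 2 ^ (2 + m + 1) = 4 * 2 ^ (m + 1) := by ring
  have h3 : 2 ≤ 2 ^ (m + 1) := by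
    rw [pow_succ]
    have := Nat.one_le_two_pow (n := m)
    omega
  rw [h1, h2]
  generalize 2 ^ (m + 1) = p at h3
  have h4 : 4 * p + (2 + m + 1) - 1 = 4 * p + (m + 2) := by omega
  rw [h4]
  nlinarith

/-- for `n ≥ 2`, the set `U_{n,1/2}` consists of exactly the
`n−1` points `((i−1)/n, 1/2, …, 1/2, −1, 1/2, …, 1/2)` (with `−1` in slot
`i`) for `i ∈ {2,…,n}`, the set `V_{n,1/2} = V_cube ∪ U_{n,1/2}` has
cardinality `2ⁿ + n − 1`, and the extreme points of `G_n^{1/2}` are exactly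
`V_{n,1/2}`.  In particular, for `n > 2` this vertex count differs from the
count `2^{n−2}(n+3)` valid for `0 ≤ ε < 1/2`. -/
theorem stmt16 (n : ℕ) [NeZero n] (hn : 2 ≤ n) :
    Uset n (1 / 2) =
        {x : Fin n → ℝ | ∃ i : Fin n, i ≠ 0 ∧
          x = fun j => if j = 0 then ((i : ℕ) : ℝ) / (n : ℝ)
            else if j = i then -1 else 1 / 2} ∧
      (Uset n (1 / 2)).ncard = n - 1 ∧
      (Vcube n ∪ Uset n (1 / 2)).ncard = 2 ^ n + n - 1 ∧
      (Gpoly n (1 / 2)).extremePoints ℝ = Vcube n ∪ Uset n (1 / 2) ∧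
      (2 < n → (2 ^ n + n - 1 : ℕ) ≠ 2 ^ (n - 2) * (n + 3)) := by
  refine ⟨Uset_half n, ncard_Uset_half n, ?_, ?_, two_pow_add_ne n⟩
  · have hV : (Vcube n).Finite := by
      rw [Vcube_eq_piFinset]
      exact Finset.finite_toSet _
    have hU : (Uset n (1 / 2)).Finite := by
      rw [Uset_half_eq_image]
      exact (Set.toFinite _).image _
    rw [Set.ncard_union_eq (disjoint_Vcube_Uset n _) hV hU, ncard_Vcube, ncard_Uset_half,
      Nat.add_sub_assoc (by omega)]
  · refine Set.Subset.antisymm extremePoints_convexHull_subset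
      (Set.union_subset (Vcube_subset_extremePoints n) ?_)
    rw [Uset_half]
    rintro _ ⟨i, hi, rfl⟩
    exact halfPoint_mem_extremePoints n hi
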